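/- arXiv:1909.00290 — 8 statements merged into one kernel-verified Lean document; each statement's English description precedes it below -/
import Mathlib

section
/- Let n ≥ 1, let H : ℝⁿ × ℝⁿ → ℝ be continuous, and let S : ℝ × ℝⁿ × ℝⁿ → ℝ be C¹ and satisfy, for all (t,x,q): ∂S/∂t(t,x,q) = H((∇_q S)(t,x,q), q) and H(x, (∇_x S)(t,x,q)) = H((∇_q S)(t,x,q), q). Let f₀ : ℝⁿ → ℝ be C¹ and let y, q : ℝ × ℝⁿ → ℝⁿ be differentiable maps satisfying the stationarity equations q(t,x) = (∇f₀)(y(t,x)) and y(t,x) = (∇_q S)(t,x,q(t,x)) for all (t,x). Define the pullback f(t,x) := f₀(y(t,x)) + S(t,x,q(t,x)) − y(t,x)·q(t,x). Then f satisfies the Hamilton–Jacobi equation: for all (t,x), ∂f/∂t(t,x) = H(x, (∇_x f)(t,x)). -/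
open scoped RealInnerProductSpace

/-- Envelope principle for a pullback by a thick morphism, with all the base variables gathered in
one parameter `p`: at a stationary point the derivative of `g (y p) + S (p, q p) - ⟪y p, q p⟫` is
the partial derivative of `S` in `p`, the variable `q` being frozen. -/
theorem hasFDerivAt_pullback_of_stationary {P F : Type*} [NormedAddCommGroup P] [NormedSpace ℝ P]
    [NormedAddCommGroup F] [InnerProductSpace ℝ F] [CompleteSpace F]
    {S : P × F → ℝ} {g : F → ℝ} {y q : P → F} {p : P}
    (hS : DifferentiableAt ℝ S (p, q p)) (hg : DifferentiableAt ℝ g (y p))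
    (hy : DifferentiableAt ℝ y p) (hq : DifferentiableAt ℝ q p)
    (hqy : q p = gradient g (y p)) (hyq : y p = gradient (fun q' => S (p, q')) (q p)) :
    HasFDerivAt (fun p' => g (y p') + S (p', q p') - ⟪y p', q p'⟫)
      ((fderiv ℝ S (p, q p)).comp (ContinuousLinearMap.inl ℝ P F)) p := by
  have hSq : HasFDerivAt (fun q' => S (p, q'))
      ((fderiv ℝ S (p, q p)).comp (ContinuousLinearMap.inr ℝ P F)) (q p) :=
    hS.hasFDerivAt.comp (q p) (hasFDerivAt_prodMk_right p (q p))
  have key_S (w : F) : fderiv ℝ S (p, q p) (0, w) = ⟪y p, w⟫ := by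
    rw [hyq, gradient, InnerProductSpace.toDual_symm_apply, hSq.fderiv]
    rfl
  have key_g (w : F) : fderiv ℝ g (y p) w = ⟪q p, w⟫ := by
    rw [hqy, gradient, InnerProductSpace.toDual_symm_apply]
  have hgy : HasFDerivAt (fun p' => g (y p')) ((fderiv ℝ g (y p)).comp (fderiv ℝ y p)) p :=
    hg.hasFDerivAt.comp p hy.hasFDerivAt
  have hSp : HasFDerivAt (fun p' => S (p', q p')) ((fderiv ℝ S (p, q p)).comp
      ((ContinuousLinearMap.id ℝ P).prod (fderiv ℝ q p))) p :=
    hS.hasFDerivAt.comp p ((hasFDerivAt_id p).prodMk hq.hasFDerivAt)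
  refine ((hgy.add hSp).sub (hy.hasFDerivAt.inner ℝ hq.hasFDerivAt)).congr_fderiv ?_
  ext v
  have hsplit : fderiv ℝ S (p, q p) (v, fderiv ℝ q p v)
      = fderiv ℝ S (p, q p) (v, 0) + ⟪y p, fderiv ℝ q p v⟫ := by
    rw [← key_S, ← map_add]
    simp
  simp [hsplit, key_g, fderivInnerCLM_apply, real_inner_comm (q p)]
  ring

/-- The pullback `f_t = Φ_t*[f₀]` of a function by a one-parameter family of thick
diffeomorphisms with generator `H` satisfies the Hamilton–Jacobi equation. -/
theorem pullback_satisfies_hamilton_jacobi (n : ℕ) (hn : 1 ≤ n)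
    (H : EuclideanSpace ℝ (Fin n) × EuclideanSpace ℝ (Fin n) → ℝ) (hH : Continuous H)
    (S : ℝ × EuclideanSpace ℝ (Fin n) × EuclideanSpace ℝ (Fin n) → ℝ)
    (hS : ContDiff ℝ 1 S)
    -- generating-function Hamilton–Jacobi equation ∂S/∂t = H(∇_q S, q)
    (hSt : ∀ t x q, deriv (fun t' => S (t', x, q)) t
      = H (gradient (fun q' => S (t, x, q')) q, q))
    -- intertwining identity H(x, ∇_x S) = H(∇_q S, q)
    (hSint : ∀ t x q, H (x, gradient (fun x' => S (t, x', q)) x)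
      = H (gradient (fun q' => S (t, x, q')) q, q))
    (f₀ : EuclideanSpace ℝ (Fin n) → ℝ) (hf₀ : ContDiff ℝ 1 f₀)
    (y q : ℝ × EuclideanSpace ℝ (Fin n) → EuclideanSpace ℝ (Fin n))
    (hy : Differentiable ℝ y) (hq : Differentiable ℝ q)
    -- stationarity equations
    (hstat1 : ∀ t x, q (t, x) = gradient f₀ (y (t, x)))
    (hstat2 : ∀ t x, y (t, x) = gradient (fun q' => S (t, x, q')) (q (t, x)))
    -- the pullback f(t,x) = f₀(y(t,x)) + S(t,x,q(t,x)) − y(t,x)·q(t,x)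
    (f : ℝ × EuclideanSpace ℝ (Fin n) → ℝ)
    (hf : ∀ t x, f (t, x) = f₀ (y (t, x)) + S (t, x, q (t, x)) - ⟪y (t, x), q (t, x)⟫) :
    ∀ t x, deriv (fun t' => f (t', x)) t = H (x, gradient (fun x' => f (t, x')) x) := by
  intro t x
  let T : (ℝ × EuclideanSpace ℝ (Fin n)) × EuclideanSpace ℝ (Fin n) → ℝ :=
    fun z => S (z.1.1, z.1.2, z.2)
  have hT : Differentiable ℝ T :=
    (hS.differentiable one_ne_zero).comp
      (g := S) (f := fun z : (ℝ × EuclideanSpace ℝ (Fin n)) × EuclideanSpace ℝ (Fin n) =>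
        (z.1.1, z.1.2, z.2)) (by fun_prop)
  have hf_eq : f = fun p => f₀ (y p) + T (p, q p) - ⟪y p, q p⟫ := by
    funext p
    exact hf p.1 p.2
  have hfT := hasFDerivAt_pullback_of_stationary (hT ((t, x), q (t, x)))
    (hf₀.differentiable one_ne_zero (y (t, x))) (hy (t, x)) (hq (t, x)) (hstat1 t x) (hstat2 t x)
  rw [← hf_eq] at hfT
  have hST : HasFDerivAt (fun p => T (p, q (t, x)))
      ((fderiv ℝ T ((t, x), q (t, x))).comp (ContinuousLinearMap.inl ℝ _ _)) (t, x) :=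
    (hT _).hasFDerivAt.comp (t, x) (hasFDerivAt_prodMk_left (t, x) (q (t, x)))
  have hderiv : deriv (fun t' => f (t', x)) t = deriv (fun t' => S (t', x, q (t, x))) t := by
    have hline : HasDerivAt (fun t' : ℝ => (t', x)) (1, 0) t :=
      (hasDerivAt_id t).prodMk (hasDerivAt_const t x)
    exact (hfT.comp_hasDerivAt t hline).deriv.trans (hST.comp_hasDerivAt t hline).deriv.symm
  have hgrad : gradient (fun x' => f (t, x')) x
      = gradient (fun x' => S (t, x', q (t, x))) x := by
    have hslice := hasFDerivAt_prodMk_right (𝕜 := ℝ) t x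
    exact congrArg (InnerProductSpace.toDual ℝ _).symm
      ((hfT.comp x hslice).fderiv.trans (hST.comp x hslice).fderiv.symm)
  rw [hderiv, hgrad, hSt, hSint]
end

section
/- Let S : ℝ × ℝⁿ × ℝᵐ → ℝ and g : ℝ × ℝᵐ → ℝ be C¹, and let y, q : ℝ × ℝⁿ → ℝᵐ be differentiable maps satisfying, for all (t,x): q(t,x) = (∇_y g)(t, y(t,x)) and y(t,x) = (∇_q S)(t, x, q(t,x)). Define f(t,x) := g(t, y(t,x)) + S(t, x, q(t,x)) − y(t,x)·q(t,x). Then for all (t,x): (a) ∂f/∂t(t,x) = (∂S/∂t)(t, x, q(t,x)) + (∂g/∂t)(t, y(t,x)); (b) (∇_x f)(t,x) = (∇_x S)(t, x, q(t,x)). -/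
open scoped RealInnerProductSpace

/-- **Envelope theorem** for the pullback by a thick morphism: the derivatives of the critical
point `(y, q)` do not contribute to the derivative of the critical value. -/
theorem hasFDerivAt_classicalPullback {E F : Type*} [NormedAddCommGroup E] [NormedSpace ℝ E]
    [NormedAddCommGroup F] [InnerProductSpace ℝ F] [CompleteSpace F]
    {S : ℝ × E × F → ℝ} {g : ℝ × F → ℝ} {y q : ℝ × E → F} {t : ℝ} {x : E}
    (hS : DifferentiableAt ℝ S (t, x, q (t, x))) (hg : DifferentiableAt ℝ g (t, y (t, x)))
    (hy : DifferentiableAt ℝ y (t, x)) (hq : DifferentiableAt ℝ q (t, x))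
    (hgrad_g : q (t, x) = gradient (fun y' => g (t, y')) (y (t, x)))
    (hgrad_S : y (t, x) = gradient (fun q' => S (t, x, q')) (q (t, x))) :
    HasFDerivAt (fun p : ℝ × E => g (p.1, y p) + S (p.1, p.2, q p) - ⟪y p, q p⟫)
      (fderiv ℝ (fun p : ℝ × E => g (p.1, y (t, x)) + S (p.1, p.2, q (t, x))) (t, x)) (t, x) := by
  have hfst : HasFDerivAt (Prod.fst : ℝ × E → ℝ) (.fst ℝ ℝ E) (t, x) := hasFDerivAt_fst
  have hsnd : HasFDerivAt (Prod.snd : ℝ × E → E) (.snd ℝ ℝ E) (t, x) := hasFDerivAt_snd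
  have hgy : ∀ v, fderiv ℝ g (t, y (t, x)) (0, v) = ⟪q (t, x), v⟫ := fun v => by
    have h : HasFDerivAt (fun y' => g (t, y')) _ (y (t, x)) :=
      hg.hasFDerivAt.comp (y (t, x)) (hasFDerivAt_prodMk_right t (y (t, x)))
    rw [hgrad_g, gradient, InnerProductSpace.toDual_symm_apply, h.fderiv]
    simp
  have hSq : ∀ v, fderiv ℝ S (t, x, q (t, x)) (0, 0, v) = ⟪y (t, x), v⟫ := fun v => by
    have h : HasFDerivAt (fun q' => S (t, x, q')) _ (q (t, x)) :=
      hS.hasFDerivAt.comp (q (t, x)) ((hasFDerivAt_const t _).prodMk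
        (hasFDerivAt_prodMk_right x (q (t, x))))
    rw [hgrad_S, gradient, InnerProductSpace.toDual_symm_apply, h.fderiv]
    simp
  have hfrozen : HasFDerivAt (fun p : ℝ × E => g (p.1, y (t, x)) + S (p.1, p.2, q (t, x))) _
      (t, x) :=
    (hg.hasFDerivAt.comp (t, x) (hfst.prodMk (hasFDerivAt_const (y (t, x)) (t, x)))).add
      (hS.hasFDerivAt.comp (t, x)
        (hfst.prodMk (hsnd.prodMk (hasFDerivAt_const (q (t, x)) (t, x)))))
  rw [hfrozen.fderiv]
  refine (((hg.hasFDerivAt.comp (t, x) (hfst.prodMk hy.hasFDerivAt)).add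
    (hS.hasFDerivAt.comp (t, x) (hfst.prodMk (hsnd.prodMk hq.hasFDerivAt)))).sub
    (hy.hasFDerivAt.inner ℝ hq.hasFDerivAt)).congr_fderiv ?_
  refine ContinuousLinearMap.ext fun v => ?_
  have hg_split : ∀ a b, fderiv ℝ g (t, y (t, x)) (a, b)
      = fderiv ℝ g (t, y (t, x)) (a, 0) + ⟪q (t, x), b⟫ := fun a b => by
    rw [← hgy, ← map_add]; simp
  have hS_split : ∀ a b c, fderiv ℝ S (t, x, q (t, x)) (a, b, c)
      = fderiv ℝ S (t, x, q (t, x)) (a, b, 0) + ⟪y (t, x), c⟫ := fun a b c => by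
    rw [← hSq, ← map_add]; simp
  simp [hg_split v.1 (fderiv ℝ y (t, x) v), hS_split v.1 v.2 (fderiv ℝ q (t, x) v),
    real_inner_comm (q (t, x))]
  ring

/-- Main derivation formula for classical thick morphisms: for a `t`-dependent
generating function `S` and `t`-dependent function `g`, the pullback
`f(t,x) = g(t,y(t,x)) + S(t,x,q(t,x)) − y(t,x)·q(t,x)` satisfies
(a) `∂f/∂t = (∂S/∂t)(t,x,q(t,x)) + (∂g/∂t)(t,y(t,x))` and
(b) `∇_x f = (∇_x S)(t,x,q(t,x))`. -/
theorem derivation_formula_classical_pullback (n m : ℕ)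
    (S : ℝ × EuclideanSpace ℝ (Fin n) × EuclideanSpace ℝ (Fin m) → ℝ)
    (hS : ContDiff ℝ 1 S)
    (g : ℝ × EuclideanSpace ℝ (Fin m) → ℝ) (hg : ContDiff ℝ 1 g)
    (y q : ℝ × EuclideanSpace ℝ (Fin n) → EuclideanSpace ℝ (Fin m))
    (hy : Differentiable ℝ y) (hq : Differentiable ℝ q)
    -- stationarity equations
    (hstat1 : ∀ t x, q (t, x) = gradient (fun y' => g (t, y')) (y (t, x)))
    (hstat2 : ∀ t x, y (t, x) = gradient (fun q' => S (t, x, q')) (q (t, x)))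
    -- the pullback
    (f : ℝ × EuclideanSpace ℝ (Fin n) → ℝ)
    (hf : ∀ t x, f (t, x) = g (t, y (t, x)) + S (t, x, q (t, x)) - ⟪y (t, x), q (t, x)⟫) :
    (∀ t x, deriv (fun t' => f (t', x)) t
        = deriv (fun t' => S (t', x, q (t, x))) t + deriv (fun t' => g (t', y (t, x))) t)
    ∧ (∀ t x, gradient (fun x' => f (t, x')) x
        = gradient (fun x' => S (t, x', q (t, x))) x) := by
  have hSd : Differentiable ℝ S := hS.differentiable one_ne_zero
  have hgd : Differentiable ℝ g := hg.differentiable one_ne_zero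
  have hfrozen : ∀ t x, DifferentiableAt ℝ (fun p : ℝ × EuclideanSpace ℝ (Fin n) =>
      g (p.1, y (t, x)) + S (p.1, p.2, q (t, x))) (t, x) := fun t x => by fun_prop
  have hfderiv : ∀ t x, HasFDerivAt f (fderiv ℝ (fun p : ℝ × EuclideanSpace ℝ (Fin n) =>
      g (p.1, y (t, x)) + S (p.1, p.2, q (t, x))) (t, x)) (t, x) := fun t x => by
    rw [show f = fun p => g (p.1, y p) + S (p.1, p.2, q p) - ⟪y p, q p⟫ from
      funext fun p => hf p.1 p.2]
    exact hasFDerivAt_classicalPullback (hSd _) (hgd _) (hy _) (hq _) (hstat1 t x) (hstat2 t x)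
  refine ⟨fun t x => ?_, fun t x => ?_⟩
  · have hline := hasFDerivAt_prodMk_left (𝕜 := ℝ) t x
    have h₁ : HasFDerivAt (fun t' => f (t', x)) _ t := (hfderiv t x).comp t hline
    have h₂ := (hfrozen t x).hasFDerivAt.comp t hline
    simp only [Function.comp_def] at h₂
    rw [add_comm, ← deriv_fun_add (by fun_prop) (by fun_prop), ← fderiv_apply_one_eq_deriv,
      ← fderiv_apply_one_eq_deriv, h₁.fderiv, h₂.fderiv]
  · have hslice := hasFDerivAt_prodMk_right (𝕜 := ℝ) t x
    have h₁ : HasFDerivAt (fun x' => f (t, x')) _ x := (hfderiv t x).comp x hslice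
    have h₂ := (hfrozen t x).hasFDerivAt.comp x hslice
    simp only [Function.comp_def] at h₂
    rw [gradient, gradient, h₁.fderiv, ← h₂.fderiv, fderiv_const_add]
end

section
/- Let H : ℝⁿ × ℝⁿ → ℝ be C¹, let f : ℝⁿ → ℝ be C¹, fix x ∈ ℝⁿ, and define for ε ∈ ℝ the generating function S_ε(x,q) := x·q + ε H(x,q). Suppose y, q : (−δ, δ) → ℝⁿ are differentiable at 0 and satisfy for all ε: q(ε) = (∇f)(y(ε)) and y(ε) = x + ε (∇_q H)(x, q(ε)) (the stationarity equations for S_ε). Define f_ε := f(y(ε)) + S_ε(x, q(ε)) − y(ε)·q(ε). Then y(0) = x, q(0) = (∇f)(x), and d/dε |_{ε=0} f_ε = H(x, (∇f)(x)). -/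
open scoped RealInnerProductSpace

/-- Infinitesimal pullback by an infinitesimal thick diffeomorphism with generating
function `S_ε(x,q) = x·q + εH(x,q)`: one has `y(0) = x`, `q(0) = ∇f(x)`, and
`d/dε|₀ Φ*_ε[f](x) = H(x, ∇f(x))`. -/
theorem infinitesimal_pullback_thick_diffeomorphism (n : ℕ) (hn : 1 ≤ n)
    (H : EuclideanSpace ℝ (Fin n) × EuclideanSpace ℝ (Fin n) → ℝ) (hH : ContDiff ℝ 1 H)
    (f : EuclideanSpace ℝ (Fin n) → ℝ) (hf : ContDiff ℝ 1 f)
    (x : EuclideanSpace ℝ (Fin n)) (δ : ℝ) (hδ : 0 < δ)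
    (y q : ℝ → EuclideanSpace ℝ (Fin n))
    (hy : DifferentiableAt ℝ y 0) (hq : DifferentiableAt ℝ q 0)
    -- stationarity equations for S_ε(x,q) = x·q + εH(x,q)
    (hstat1 : ∀ ε ∈ Set.Ioo (-δ) δ, q ε = gradient f (y ε))
    (hstat2 : ∀ ε ∈ Set.Ioo (-δ) δ,
      y ε = x + ε • gradient (fun q' => H (x, q')) (q ε))
    -- the pullback f_ε = f(y(ε)) + S_ε(x, q(ε)) − y(ε)·q(ε)
    (fε : ℝ → ℝ)
    (hfε : ∀ ε, fε ε = f (y ε) + (⟪x, q ε⟫ + ε * H (x, q ε)) - ⟪y ε, q ε⟫) :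
    y 0 = x ∧ q 0 = gradient f x ∧ deriv fε 0 = H (x, gradient f x) := by
  have h0 : (0 : ℝ) ∈ Set.Ioo (-δ) δ := ⟨neg_lt_zero.mpr hδ, hδ⟩
  have hy0 : y 0 = x := by simpa using hstat2 0 h0
  have hq0 : q 0 = gradient f x := by rw [hstat1 0 h0, hy0]
  refine ⟨hy0, hq0, ?_⟩
  have hfy : HasDerivAt (fun ε => f (y ε)) ⟪q 0, deriv y 0⟫ 0 := by
    have hgrad := (hf.differentiable one_ne_zero (y 0)).hasGradientAt
    rw [← hstat1 0 h0] at hgrad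
    exact hgrad.hasFDerivAt.comp_hasDerivAt (0 : ℝ) hy.hasDerivAt
  have hHq : DifferentiableAt ℝ (fun ε => H (x, q ε)) 0 :=
    (hH.differentiable one_ne_zero (x, q 0)).comp (0 : ℝ)
      ((differentiableAt_const x).prodMk hq)
  have hxq := (hasDerivAt_const (0 : ℝ) x).inner ℝ hq.hasDerivAt
  have hyq := hy.hasDerivAt.inner ℝ hq.hasDerivAt
  have hεH := (hasDerivAt_id (0 : ℝ)).mul hHq.hasDerivAt
  have hfε' : HasDerivAt fε _ 0 :=
    ((hfy.add (hxq.add hεH)).sub hyq).congr_of_eventuallyEq (.of_forall hfε)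
  rw [hfε'.deriv, ← hq0, hy0, real_inner_comm (deriv y 0) (q 0)]
  simp only [inner_zero_left, id_eq]
  ring
end

section
/- Let S : ℝⁿ × ℝᵐ → ℝ be C¹, let g : ℝᵐ → ℝ be C¹ and h : ℝᵐ → ℝ be C¹. Fix x ∈ ℝⁿ, and suppose y, q : (−δ,δ) → ℝᵐ are differentiable at 0 and satisfy, for all ε ∈ (−δ,δ): q(ε) = (∇g)(y(ε)) + ε(∇h)(y(ε)) and y(ε) = (∇_q S)(x, q(ε)) (the stationarity equations for the pullback of g + εh). Define f(ε) := g(y(ε)) + ε h(y(ε)) + S(x, q(ε)) − y(ε)·q(ε). Then d/dε |_{ε=0} f(ε) = h(y(0)). -/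
open scoped RealInnerProductSpace

/-- Chain rule along a curve, in terms of the gradient. -/
theorem HasGradientAt.hasDerivAt_comp_curve {E : Type*} [NormedAddCommGroup E]
    [InnerProductSpace ℝ E] [CompleteSpace E] {φ : E → ℝ} {v c' : E} {c : ℝ → E} {t : ℝ}
    (hφ : HasGradientAt φ v (c t)) (hc : HasDerivAt c c' t) :
    HasDerivAt (fun s => φ (c s)) ⟪v, c'⟫ t := by
  simpa [Function.comp_def] using hφ.hasFDerivAt.comp_hasDerivAt t hc

/-- Derivative of the nonlinear pullback by a classical thick morphism:
the Gateaux derivative of `g ↦ Φ*[g]` at `g` in the direction `h` is the ordinary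
pullback of `h` by the perturbed map, i.e. `d/dε|₀ Φ*[g+εh](x) = h(y(0))`. -/
theorem derivative_of_nonlinear_pullback (n m : ℕ)
    (S : EuclideanSpace ℝ (Fin n) × EuclideanSpace ℝ (Fin m) → ℝ) (hS : ContDiff ℝ 1 S)
    (g h : EuclideanSpace ℝ (Fin m) → ℝ) (hg : ContDiff ℝ 1 g) (hh : ContDiff ℝ 1 h)
    (x : EuclideanSpace ℝ (Fin n)) (δ : ℝ) (hδ : 0 < δ)
    (y q : ℝ → EuclideanSpace ℝ (Fin m))
    (hy : DifferentiableAt ℝ y 0) (hq : DifferentiableAt ℝ q 0)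
    -- stationarity equations for the pullback of g + εh
    (hstat1 : ∀ ε ∈ Set.Ioo (-δ) δ, q ε = gradient g (y ε) + ε • gradient h (y ε))
    (hstat2 : ∀ ε ∈ Set.Ioo (-δ) δ, y ε = gradient (fun q' => S (x, q')) (q ε))
    -- the pullback of g + εh
    (f : ℝ → ℝ)
    (hf : ∀ ε, f ε = g (y ε) + ε * h (y ε) + S (x, q ε) - ⟪y ε, q ε⟫) :
    deriv f 0 = h (y 0) := by
  have h0 : (0 : ℝ) ∈ Set.Ioo (-δ) δ := ⟨neg_lt_zero.mpr hδ, hδ⟩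
  have hq0 : gradient g (y 0) = q 0 := by simpa using (hstat1 0 h0).symm
  have hSx : Differentiable ℝ fun q' => S (x, q') :=
    (hS.differentiable one_ne_zero).comp
      ((differentiable_const x).prodMk differentiable_id)
  have dg := ((hg.differentiable one_ne_zero) (y 0)).hasGradientAt.hasDerivAt_comp_curve
    hy.hasDerivAt
  have dh := ((hh.differentiable one_ne_zero) (y 0)).hasGradientAt.hasDerivAt_comp_curve
    hy.hasDerivAt
  have dS := (hSx (q 0)).hasGradientAt.hasDerivAt_comp_curve hq.hasDerivAt
  rw [hq0] at dg
  rw [← hstat2 0 h0] at dS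
  have df := ((dg.add ((hasDerivAt_id (0 : ℝ)).mul dh)).add dS).sub
    (hy.hasDerivAt.inner ℝ hq.hasDerivAt)
  rw [funext hf]
  refine df.deriv.trans ?_
  rw [real_inner_comm (q 0) (deriv y 0)]
  simp only [id]
  ring
end

section
/- Let S21 : ℝ^{n₁} × ℝ^{n₂} → ℝ, S32 : ℝ^{n₂} × ℝ^{n₃} → ℝ, and g : ℝ^{n₃} → ℝ be C¹. Let z, r : ℝ^{n₂} → ℝ^{n₃} be C¹ maps with r(y) = (∇g)(z(y)) and z(y) = (∇_r S32)(y, r(y)) for all y, and set g₂(y) := g(z(y)) + S32(y, r(y)) − z(y)·r(y) (the pullback of g through S32). Fix x ∈ ℝ^{n₁} and let y₁, q₁ ∈ ℝ^{n₂} satisfy q₁ = (∇_y S32)(y₁, r(y₁)) and y₁ = (∇_q S21)(x, q₁). Let y₀, q₀ : ℝ^{n₁} × ℝ^{n₃} → ℝ^{n₂} be differentiable maps satisfying q₀(X,R) = (∇_y S32)(y₀(X,R), R) and y₀(X,R) = (∇_q S21)(X, q₀(X,R)) for all (X,R), and suppose y₀(x, r(y₁)) = y₁ and q₀(x, r(y₁))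 = q₁. Define S31(X,R) := S32(y₀(X,R), R) + S21(X, q₀(X,R)) − y₀(X,R)·q₀(X,R). Then: (a) (∇g₂)(y₁) = q₁, so (y₁, q₁) are valid stationarity data for the pullback of g₂ through S21; (b) r(y₁) = (∇g)(z(y₁)) and z(y₁) = (∇_R S31)(x, r(y₁)), so (z(y₁), r(y₁)) are valid stationarity data for the pullback of g through S31; (c) g₂(y₁) + S21(x, q₁) − y₁·q₁ = g(z(y₁)) + S31(x, r(y₁)) − z(y₁)·r(y₁). -/
open scoped RealInnerProductSpace

/-- The envelope formula: if `ψ t = ∇f (φ t)` and `φ t` is the gradient of `K` in its first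
variable at `(ψ t, t)`, then the gradient at `t` of `f ∘ φ + K (ψ ·, ·) - ⟪φ, ψ⟫` is the gradient
of `K` in its second variable. -/
theorem hasGradientAt_of_stationary {E F : Type*}
    [NormedAddCommGroup E] [InnerProductSpace ℝ E] [CompleteSpace E]
    [NormedAddCommGroup F] [InnerProductSpace ℝ F] [CompleteSpace F]
    {f : F → ℝ} {K : F × E → ℝ} {φ ψ : E → F} {t : E}
    (hf : DifferentiableAt ℝ f (φ t)) (hK : DifferentiableAt ℝ K (ψ t, t))
    (hφ : DifferentiableAt ℝ φ t) (hψ : DifferentiableAt ℝ ψ t)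
    (hψf : ψ t = gradient f (φ t)) (hφK : φ t = gradient (fun p => K (p, t)) (ψ t)) :
    HasGradientAt (fun s => f (φ s) + K (ψ s, s) - ⟪φ s, ψ s⟫)
      (gradient (fun s => K (ψ t, s)) t) t := by
  have hfg := hf.hasGradientAt.hasFDerivAt
  rw [← hψf] at hfg
  have hK₁ : HasFDerivAt (fun p => K (p, t)) _ (ψ t) :=
    hK.hasFDerivAt.comp (ψ t) (hasFDerivAt_prodMk_left (ψ t) t)
  have hK₂ : HasFDerivAt (fun s => K (ψ t, s)) _ t :=
    hK.hasFDerivAt.comp t (hasFDerivAt_prodMk_right (ψ t) t)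
  have hg₁ := hK₁.differentiableAt.hasGradientAt.hasFDerivAt
  rw [← hφK] at hg₁
  have h₁ := hK₁.unique hg₁
  have h₂ := hK₂.unique hK₂.differentiableAt.hasGradientAt.hasFDerivAt
  have hKψ : HasFDerivAt (fun s => K (ψ s, s)) _ t :=
    HasFDerivAt.comp (f := fun s => (ψ s, s)) t hK.hasFDerivAt
      (hψ.hasFDerivAt.prodMk (hasFDerivAt_id t))
  have hsum := ((hfg.comp t hφ.hasFDerivAt).add hKψ).sub
    (hφ.hasFDerivAt.inner ℝ hψ.hasFDerivAt)
  rw [hasGradientAt_iff_hasFDerivAt]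
  refine hsum.congr_fderiv ?_
  ext v
  have e₁ := DFunLike.congr_fun h₁ (fderiv ℝ ψ t v)
  have e₂ := DFunLike.congr_fun h₂ v
  have e₃ : fderiv ℝ K (ψ t, t) (fderiv ℝ ψ t v, v)
      = fderiv ℝ K (ψ t, t) (fderiv ℝ ψ t v, 0) + fderiv ℝ K (ψ t, t) (0, v) := by
    rw [← map_add]
    simp
  simp only [ContinuousLinearMap.comp_apply, ContinuousLinearMap.inl_apply,
    ContinuousLinearMap.inr_apply, InnerProductSpace.toDual_apply_apply] at e₁ e₂
  simp [fderivInnerCLM_apply, e₁, e₂, e₃, real_inner_comm]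
  ring

/-- Functoriality of nonlinear pullbacks: `(Φ32 ∘ Φ21)* = Φ21* ∘ Φ32*`. Pulling back
`g` first through `S32` (giving `g₂`) and then through `S21` gives at `x` the same
value as pulling back `g` through the composed generating function `S31`. -/
theorem functoriality_of_pullbacks (n₁ n₂ n₃ : ℕ)
    (S21 : EuclideanSpace ℝ (Fin n₁) × EuclideanSpace ℝ (Fin n₂) → ℝ)
    (S32 : EuclideanSpace ℝ (Fin n₂) × EuclideanSpace ℝ (Fin n₃) → ℝ)
    (g : EuclideanSpace ℝ (Fin n₃) → ℝ)
    (hS21 : ContDiff ℝ 1 S21) (hS32 : ContDiff ℝ 1 S32) (hg : ContDiff ℝ 1 g)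
    -- pullback of g through S32
    (z r : EuclideanSpace ℝ (Fin n₂) → EuclideanSpace ℝ (Fin n₃))
    (hz : ContDiff ℝ 1 z) (hr : ContDiff ℝ 1 r)
    (hzr1 : ∀ y, r y = gradient g (z y))
    (hzr2 : ∀ y, z y = gradient (fun r' => S32 (y, r')) (r y))
    (g₂ : EuclideanSpace ℝ (Fin n₂) → ℝ)
    (hg₂ : ∀ y, g₂ y = g (z y) + S32 (y, r y) - ⟪z y, r y⟫)
    -- stationarity data for the pullback through S21 at the point x
    (x : EuclideanSpace ℝ (Fin n₁))
    (y₁ q₁ : EuclideanSpace ℝ (Fin n₂))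
    (hq₁ : q₁ = gradient (fun y' => S32 (y', r y₁)) y₁)
    (hy₁ : y₁ = gradient (fun q' => S21 (x, q')) q₁)
    -- stationarity data for the composition
    (y₀ q₀ : EuclideanSpace ℝ (Fin n₁) × EuclideanSpace ℝ (Fin n₃) → EuclideanSpace ℝ (Fin n₂))
    (hy₀d : Differentiable ℝ y₀) (hq₀d : Differentiable ℝ q₀)
    (h01 : ∀ X R, q₀ (X, R) = gradient (fun y' => S32 (y', R)) (y₀ (X, R)))
    (h02 : ∀ X R, y₀ (X, R) = gradient (fun q' => S21 (X, q')) (q₀ (X, R)))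
    (hmatch1 : y₀ (x, r y₁) = y₁) (hmatch2 : q₀ (x, r y₁) = q₁)
    -- the composed generating function
    (S31 : EuclideanSpace ℝ (Fin n₁) × EuclideanSpace ℝ (Fin n₃) → ℝ)
    (hS31 : ∀ X R, S31 (X, R)
      = S32 (y₀ (X, R), R) + S21 (X, q₀ (X, R)) - ⟪y₀ (X, R), q₀ (X, R)⟫) :
    -- (a) (y₁,q₁) are valid stationarity data for the pullback of g₂ through S21
    gradient g₂ y₁ = q₁
    -- (b) (z(y₁), r(y₁)) are valid stationarity data for the pullback of g through S31
    ∧ (r y₁ = gradient g (z y₁)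
        ∧ z y₁ = gradient (fun R' => S31 (x, R')) (r y₁))
    -- (c) the two pullbacks agree at x
    ∧ g₂ y₁ + S21 (x, q₁) - ⟪y₁, q₁⟫
        = g (z y₁) + S31 (x, r y₁) - ⟪z y₁, r y₁⟫ := by
  have d21 := hS21.differentiable one_ne_zero
  have d32 := hS32.differentiable one_ne_zero
  refine ⟨?_, ⟨hzr1 y₁, ?_⟩, ?_⟩
  · have h := hasGradientAt_of_stationary (f := g) (K := fun p => S32 (p.2, p.1))
      (φ := z) (ψ := r) (t := y₁) (hg.differentiable one_ne_zero _)
      (by fun_prop) (hz.differentiable one_ne_zero _) (hr.differentiable one_ne_zero _)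
      (hzr1 y₁) (hzr2 y₁)
    rw [funext hg₂, hq₁]
    exact h.gradient
  · have h := hasGradientAt_of_stationary (f := fun q => S21 (x, q)) (K := S32)
      (φ := fun R => q₀ (x, R)) (ψ := fun R => y₀ (x, R)) (t := r y₁)
      (by fun_prop) (d32 _) (by fun_prop) (by fun_prop) (h02 x _) (h01 x _)
    have hS : (fun R => S31 (x, R))
        = fun R => S21 (x, q₀ (x, R)) + S32 (y₀ (x, R), R) - ⟪q₀ (x, R), y₀ (x, R)⟫ := by
      funext R
      rw [hS31, real_inner_comm, add_comm]
    rw [hS, h.gradient, hmatch1]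
    exact hzr2 y₁
  · rw [hg₂, hS31, hmatch1, hmatch2]
    ring
end

section
/- Let n, m ≥ 1. Let H₁(x,p) := A·x + B·p + K₁ (A, B ∈ ℝⁿ, K₁ ∈ ℝ) be a linear Hamiltonian on ℝⁿ × ℝⁿ and H₂(y,q) := C·y + D·q + K₂ (C, D ∈ ℝᵐ, K₂ ∈ ℝ) a linear Hamiltonian on ℝᵐ × ℝᵐ. Let S be a quadratic generating function on ℝⁿ × ℝᵐ with data (s₀, s₁, s₂, S₁₁, S₁₂, S₂₂). Then the Hamilton–Jacobi (intertwining) equation H₁(x, (∇_x S)(x,q)) = H₂((∇_q S)(x,q), q) holds for all (x,q) ∈ ℝⁿ × ℝᵐ if and only if the following three relations hold: (1) B·s₁ + K₁ = C·s₂ + K₂; (2) A + S₁₁B = S₁₂C; (3) S₁₂ᵀB = S₂₂C + D. -/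
open Matrix

/-- Classical part of Theorem 3.4: for linear Hamiltonians
`H₁(x,p) = A·x + B·p + K₁`, `H₂(y,q) = C·y + D·q + K₂` and a quadratic generating
function `S` with data `(s₀,s₁,s₂,S₁₁,S₁₂,S₂₂)` (so `∇_x S = s₁ + S₁₁x + S₁₂q` and
`∇_q S = s₂ + S₁₂ᵀx + S₂₂q`), the Hamilton–Jacobi equation
`H₁(x, ∇_x S) = H₂(∇_q S, q)` holds for all `(x,q)` iff
`(1) B·s₁ + K₁ = C·s₂ + K₂`, `(2) A + S₁₁B = S₁₂C`, `(3) S₁₂ᵀB = S₂₂C + D`. -/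
theorem hamilton_jacobi_iff_coefficient_relations (n m : ℕ) (hn : 1 ≤ n) (hm : 1 ≤ m)
    (A B : Fin n → ℝ) (K₁ : ℝ) (C D : Fin m → ℝ) (K₂ : ℝ)
    (s₀ : ℝ) (s₁ : Fin n → ℝ) (s₂ : Fin m → ℝ)
    (S₁₁ : Matrix (Fin n) (Fin n) ℝ) (S₁₂ : Matrix (Fin n) (Fin m) ℝ)
    (S₂₂ : Matrix (Fin m) (Fin m) ℝ)
    (hS₁₁ : S₁₁.IsSymm) (hS₂₂ : S₂₂.IsSymm) :
    (∀ (x : Fin n → ℝ) (q : Fin m → ℝ),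
        A ⬝ᵥ x + B ⬝ᵥ (s₁ + S₁₁.mulVec x + S₁₂.mulVec q) + K₁
          = C ⬝ᵥ (s₂ + S₁₂ᵀ.mulVec x + S₂₂.mulVec q) + D ⬝ᵥ q + K₂)
    ↔ (B ⬝ᵥ s₁ + K₁ = C ⬝ᵥ s₂ + K₂
        ∧ A + S₁₁.mulVec B = S₁₂.mulVec C
        ∧ S₁₂ᵀ.mulVec B = S₂₂.mulVec C + D) := by
  have expand : ∀ (x : Fin n → ℝ) (q : Fin m → ℝ),
      (A ⬝ᵥ x + B ⬝ᵥ (s₁ + S₁₁.mulVec x + S₁₂.mulVec q) + K₁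
          = C ⬝ᵥ (s₂ + S₁₂ᵀ.mulVec x + S₂₂.mulVec q) + D ⬝ᵥ q + K₂) ↔
      (B ⬝ᵥ s₁ + K₁ + (A + S₁₁.mulVec B) ⬝ᵥ x + S₁₂ᵀ.mulVec B ⬝ᵥ q
          = C ⬝ᵥ s₂ + K₂ + S₁₂.mulVec C ⬝ᵥ x + (S₂₂.mulVec C + D) ⬝ᵥ q) := by
    intro x q
    have h₁₁ : B ⬝ᵥ S₁₁.mulVec x = S₁₁.mulVec B ⬝ᵥ x := by
      rw [dotProduct_mulVec, ← mulVec_transpose, hS₁₁.eq]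
    have h₂₂ : C ⬝ᵥ S₂₂.mulVec q = S₂₂.mulVec C ⬝ᵥ q := by
      rw [dotProduct_mulVec, ← mulVec_transpose, hS₂₂.eq]
    have h₁₂ : B ⬝ᵥ S₁₂.mulVec q = S₁₂ᵀ.mulVec B ⬝ᵥ q := by
      rw [dotProduct_mulVec, ← mulVec_transpose]
    have h₂₁ : C ⬝ᵥ S₁₂ᵀ.mulVec x = S₁₂.mulVec C ⬝ᵥ x := by
      rw [dotProduct_mulVec, vecMul_transpose]
    simp only [dotProduct_add, add_dotProduct, h₁₁, h₂₂, h₁₂, h₂₁]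
    constructor <;> intro h <;> linarith
  simp only [expand]
  constructor
  · intro h
    have h₀ : B ⬝ᵥ s₁ + K₁ = C ⬝ᵥ s₂ + K₂ := by simpa using h 0 0
    refine ⟨h₀, dotProduct_eq _ _ fun x => ?_, dotProduct_eq _ _ fun q => ?_⟩
    · simpa only [dotProduct_zero, add_zero, h₀, add_right_inj] using h x 0
    · simpa only [dotProduct_zero, add_zero, h₀, add_right_inj] using h 0 q
  · rintro ⟨h₀, hx, hq⟩ x q
    rw [h₀, hx, hq]
end

section
/- Let n₁, n₂, n₃ ≥ 1. Let S21 be a quadratic generating function on ℝ^{n₁} × ℝ^{n₂} with data (s₀, s₁, s₂, S₁₁, S₁₂, S₂₂), and S32 a quadratic generating function on ℝ^{n₂} × ℝ^{n₃} with data (t₀, t₁, t₂, T₁₁, T₁₂, T₂₂). Fix x ∈ ℝ^{n₁} and r ∈ ℝ^{n₃}, and define F : ℝ^{n₂} × ℝ^{n₂} → ℝ by F(y,q) := S32(y,r) + S21(x,q) − y·q. Then: (a) (y,q) is a critical point of F if and only if q = (∇_y S32)(y, r) and y = (∇_q S21)(x, q); (b) F has exactly one critical point for every choice of (x,r) if and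 only if the n₂×n₂ matrix 1 − T₁₁S₂₂ is invertible. -/
open Matrix

/-- The Leibniz rule for the dot product of two differentiable vector-valued maps. -/
theorem HasFDerivAt.exists_dotProduct {E : Type*} [NormedAddCommGroup E] [NormedSpace ℝ E]
    {n : ℕ} {f g : E → Fin n → ℝ} {f' g' : E →L[ℝ] (Fin n → ℝ)} {x : E}
    (hf : HasFDerivAt f f' x) (hg : HasFDerivAt g g' x) :
    ∃ L : E →L[ℝ] ℝ, HasFDerivAt (fun e => f e ⬝ᵥ g e) L x ∧
      ∀ v, L v = f x ⬝ᵥ g' v + f' v ⬝ᵥ g x := by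
  rw [hasFDerivAt_pi'] at hf hg
  refine ⟨_, HasFDerivAt.fun_sum fun i _ => (hf i).mul (hg i), fun v => ?_⟩
  simp [dotProduct, Finset.sum_add_distrib, mul_comm]

/-- The derivative of `y ↦ ½ y·(A y) + a·y + c` for symmetric `A`, precomposed with a
continuous linear map `P`. -/
theorem Matrix.IsSymm.exists_hasFDerivAt_quadratic {E : Type*} [NormedAddCommGroup E]
    [NormedSpace ℝ E] {n : ℕ} {A : Matrix (Fin n) (Fin n) ℝ} (hA : A.IsSymm)
    (a : Fin n → ℝ) (c : ℝ) (P : E →L[ℝ] (Fin n → ℝ)) (x : E) :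
    ∃ L : E →L[ℝ] ℝ,
      HasFDerivAt (fun e => (1/2) * (P e ⬝ᵥ A *ᵥ P e) + a ⬝ᵥ P e + c) L x ∧
      ∀ v, L v = (a + A *ᵥ P x) ⬝ᵥ P v := by
  have hAP := (A.mulVecLin.toContinuousLinearMap.comp P).hasFDerivAt (x := x)
  obtain ⟨L₁, h₁, e₁⟩ := P.hasFDerivAt.exists_dotProduct hAP
  obtain ⟨L₂, h₂, e₂⟩ := (hasFDerivAt_const a x).exists_dotProduct P.hasFDerivAt
  refine ⟨_, ((h₁.const_mul (1/2)).add h₂).add_const c, fun v => ?_⟩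
  have hsymm : P x ⬝ᵥ A *ᵥ P v = A *ᵥ P x ⬝ᵥ P v := by
    rw [dotProduct_mulVec, ← mulVec_transpose, hA.eq]
  simp [e₁, e₂, hsymm, add_dotProduct, dotProduct_comm (P v)]
  ring

/-- Critical points of `½ y·(T y) + a·y + c + ½ q·(S q) + b·q + d - y·q`. -/
theorem fderiv_quadratic_sub_pairing_eq_zero_iff {n : ℕ} {T S : Matrix (Fin n) (Fin n) ℝ}
    (hT : T.IsSymm) (hS : S.IsSymm) (a b : Fin n → ℝ) (c d : ℝ) (y q : Fin n → ℝ) :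
    fderiv ℝ (fun p : (Fin n → ℝ) × (Fin n → ℝ) =>
      ((1/2) * (p.1 ⬝ᵥ T *ᵥ p.1) + a ⬝ᵥ p.1 + c) + ((1/2) * (p.2 ⬝ᵥ S *ᵥ p.2) + b ⬝ᵥ p.2 + d)
        - p.1 ⬝ᵥ p.2) (y, q) = 0 ↔ q = a + T *ᵥ y ∧ y = b + S *ᵥ q := by
  let P := ContinuousLinearMap.fst ℝ (Fin n → ℝ) (Fin n → ℝ)
  let Q := ContinuousLinearMap.snd ℝ (Fin n → ℝ) (Fin n → ℝ)
  obtain ⟨L₁, h₁, e₁⟩ := hT.exists_hasFDerivAt_quadratic a c P (y, q)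
  obtain ⟨L₂, h₂, e₂⟩ := hS.exists_hasFDerivAt_quadratic b d Q (y, q)
  obtain ⟨L₃, h₃, e₃⟩ :=
    (P.hasFDerivAt (x := (y, q))).exists_dotProduct (Q.hasFDerivAt (x := (y, q)))
  have hL : ∀ h k, (L₁ + L₂ - L₃) (h, k) =
      (a + T *ᵥ y - q) ⬝ᵥ h + (b + S *ᵥ q - y) ⬝ᵥ k := by
    intro h k
    simp only [_root_.sub_apply, _root_.add_apply, e₁, e₂, e₃]
    simp only [P, Q, ContinuousLinearMap.coe_fst', ContinuousLinearMap.coe_snd',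
      sub_dotProduct, dotProduct_comm h q]
    ring
  have hfd := ((h₁.add h₂).sub h₃).fderiv
  refine (Eq.congr_left hfd).trans ⟨fun h0 => ⟨?_, ?_⟩, fun ⟨hq, hy⟩ => ?_⟩
  · refine (sub_eq_zero.mp (dotProduct_eq_zero _ fun h => ?_)).symm
    simpa [h0] using (hL h 0).symm
  · refine (sub_eq_zero.mp (dotProduct_eq_zero _ fun k => ?_)).symm
    simpa [h0] using (hL 0 k).symm
  · refine ContinuousLinearMap.ext fun ⟨h, k⟩ => ?_
    rw [hL, ← hq, ← hy]
    simp

/-- The system `q = a + T y`, `y = b + S q` is uniquely solvable iff `1 - T S` is invertible. -/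
theorem existsUnique_coupled_system_iff {n : ℕ} (T S : Matrix (Fin n) (Fin n) ℝ)
    (a b : Fin n → ℝ) :
    (∃! p : (Fin n → ℝ) × (Fin n → ℝ), p.2 = a + T *ᵥ p.1 ∧ p.1 = b + S *ᵥ p.2) ↔
      IsUnit (1 - T * S) := by
  constructor
  · rintro ⟨⟨y, q⟩, ⟨hq, hy⟩, huniq⟩
    rw [← mulVec_injective_iff_isUnit, ← coe_mulVecLin, injective_iff_map_eq_zero]
    intro v hv
    have hv' : v = T *ᵥ (S *ᵥ v) := by
      simpa [sub_mulVec, sub_eq_zero] using hv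
    have key := huniq (y + S *ᵥ v, q + v) ⟨?_, ?_⟩
    · simpa using congrArg Prod.snd key
    · change q + v = a + T *ᵥ (y + S *ᵥ v)
      rw [mulVec_add, ← hv', ← add_assoc, ← hq]
    · change y + S *ᵥ v = b + S *ᵥ (q + v)
      rw [mulVec_add, ← add_assoc, ← hy]
  · intro hu
    have hred : ∀ q, q = a + T *ᵥ (b + S *ᵥ q) ↔ (1 - T * S) *ᵥ q = a + T *ᵥ b := by
      intro q
      rw [mulVec_add, ← add_assoc, sub_mulVec, one_mulVec, ← mulVec_mulVec, sub_eq_iff_eq_add]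
    obtain ⟨q, hq⟩ := mulVec_surjective_iff_isUnit.mpr hu (a + T *ᵥ b)
    refine ⟨(b + S *ᵥ q, q), ⟨(hred q).mpr hq, rfl⟩, ?_⟩
    rintro ⟨y', q'⟩ ⟨hq', hy'⟩
    obtain rfl : y' = b + S *ᵥ q' := hy'
    obtain rfl : q' = q := mulVec_injective_iff_isUnit.mpr hu (((hred q').mp hq').trans hq.symm)
    rfl

/-- Stationary-point system for the composition of quantum thick morphisms with
quadratic actions: the critical points of `F(y,q) = S32(y,r) + S21(x,q) − y·q` are
exactly the solutions of `q = ∇_y S32(y,r)`, `y = ∇_q S21(x,q)`; and `F` has exactly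
one critical point for every `(x,r)` iff the matrix `1 − T₁₁S₂₂` is invertible. -/
theorem critical_points_of_composition (n₁ n₂ n₃ : ℕ)
    (hn₁ : 1 ≤ n₁) (hn₂ : 1 ≤ n₂) (hn₃ : 1 ≤ n₃)
    (s₀ : ℝ) (s₁ : Fin n₁ → ℝ) (s₂ : Fin n₂ → ℝ)
    (S₁₁ : Matrix (Fin n₁) (Fin n₁) ℝ) (S₁₂ : Matrix (Fin n₁) (Fin n₂) ℝ)
    (S₂₂ : Matrix (Fin n₂) (Fin n₂) ℝ) (hS₁₁ : S₁₁.IsSymm) (hS₂₂ : S₂₂.IsSymm)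
    (t₀ : ℝ) (t₁ : Fin n₂ → ℝ) (t₂ : Fin n₃ → ℝ)
    (T₁₁ : Matrix (Fin n₂) (Fin n₂) ℝ) (T₁₂ : Matrix (Fin n₂) (Fin n₃) ℝ)
    (T₂₂ : Matrix (Fin n₃) (Fin n₃) ℝ) (hT₁₁ : T₁₁.IsSymm) (hT₂₂ : T₂₂.IsSymm)
    (S21 : (Fin n₁ → ℝ) → (Fin n₂ → ℝ) → ℝ)
    (hS21 : ∀ x q, S21 x q = s₀ + s₁ ⬝ᵥ x + s₂ ⬝ᵥ q + (1/2) * (x ⬝ᵥ S₁₁.mulVec x)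
      + x ⬝ᵥ S₁₂.mulVec q + (1/2) * (q ⬝ᵥ S₂₂.mulVec q))
    (S32 : (Fin n₂ → ℝ) → (Fin n₃ → ℝ) → ℝ)
    (hS32 : ∀ y r, S32 y r = t₀ + t₁ ⬝ᵥ y + t₂ ⬝ᵥ r + (1/2) * (y ⬝ᵥ T₁₁.mulVec y)
      + y ⬝ᵥ T₁₂.mulVec r + (1/2) * (r ⬝ᵥ T₂₂.mulVec r))
    (F : (Fin n₁ → ℝ) → (Fin n₃ → ℝ) → (Fin n₂ → ℝ) × (Fin n₂ → ℝ) → ℝ)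
    (hF : ∀ x r yq, F x r yq = S32 yq.1 r + S21 x yq.2 - yq.1 ⬝ᵥ yq.2) :
    -- (a) critical points are the solutions of the composition equations
    (∀ x r (y q : Fin n₂ → ℝ),
        fderiv ℝ (F x r) (y, q) = 0
          ↔ (q = t₁ + T₁₁.mulVec y + T₁₂.mulVec r
              ∧ y = s₂ + S₁₂ᵀ.mulVec x + S₂₂.mulVec q))
    -- (b) unique critical point for every (x,r) iff 1 − T₁₁S₂₂ is invertible
    ∧ ((∀ x r, ∃! yq : (Fin n₂ → ℝ) × (Fin n₂ → ℝ), fderiv ℝ (F x r) yq = 0)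
        ↔ IsUnit (1 - T₁₁ * S₂₂)) := by
  have hcrit : ∀ x r (y q : Fin n₂ → ℝ), fderiv ℝ (F x r) (y, q) = 0
      ↔ (q = t₁ + T₁₁.mulVec y + T₁₂.mulVec r
          ∧ y = s₂ + S₁₂ᵀ.mulVec x + S₂₂.mulVec q) := by
    intro x r y q
    have hFxr : F x r = fun p =>
        ((1/2) * (p.1 ⬝ᵥ T₁₁ *ᵥ p.1) + (t₁ + T₁₂ *ᵥ r) ⬝ᵥ p.1
          + (t₀ + t₂ ⬝ᵥ r + (1/2) * (r ⬝ᵥ T₂₂ *ᵥ r)))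
        + ((1/2) * (p.2 ⬝ᵥ S₂₂ *ᵥ p.2) + (s₂ + S₁₂ᵀ *ᵥ x) ⬝ᵥ p.2
          + (s₀ + s₁ ⬝ᵥ x + (1/2) * (x ⬝ᵥ S₁₁ *ᵥ x))) - p.1 ⬝ᵥ p.2 := by
      funext p
      rw [hF, hS32, hS21, add_dotProduct, add_dotProduct, dotProduct_comm (T₁₂ *ᵥ r),
        mulVec_transpose, ← dotProduct_mulVec]
      ring
    rw [hFxr, fderiv_quadratic_sub_pairing_eq_zero_iff hT₁₁ hS₂₂, add_right_comm t₁]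
  refine ⟨hcrit, ?_⟩
  have huniq : ∀ x r, (∃! yq : (Fin n₂ → ℝ) × (Fin n₂ → ℝ), fderiv ℝ (F x r) yq = 0) ↔
      IsUnit (1 - T₁₁ * S₂₂) := by
    intro x r
    rw [← existsUnique_coupled_system_iff T₁₁ S₂₂ (t₁ + T₁₂ *ᵥ r) (s₂ + S₁₂ᵀ *ᵥ x)]
    refine existsUnique_congr fun p => ?_
    rw [← Prod.mk.eta (p := p), hcrit, add_right_comm t₁]
  exact ⟨fun h => (huniq 0 0).mp (h 0 0), fun h x r => (huniq x r).mpr h⟩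
end

section
/- Let n₁, n₂, n₃ ≥ 1. Let S21 be a quadratic generating function on ℝ^{n₁} × ℝ^{n₂} (q-quadratic block S₂₂) and S32 a quadratic generating function on ℝ^{n₂} × ℝ^{n₃} (y-quadratic block T₁₁), and assume 1 − T₁₁S₂₂ is invertible. For each (x,r) let (y₀(x,r), q₀(x,r)) be the unique pair with q₀(x,r) = (∇_y S32)(y₀(x,r), r) and y₀(x,r) = (∇_q S21)(x, q₀(x,r)), and define S31(x,r) := S32(y₀(x,r), r) + S21(x, q₀(x,r)) − y₀(x,r)·q₀(x,r). For a C¹ generating function S on ℝⁿ × ℝᵐ, let R(S) := {(x,p,y,q) ∈ ℝⁿ × ℝⁿ × ℝᵐ × ℝᵐ : p = (∇_x S)(x,q) and y = (∇_q S)(x,q)} be the canonical relation it generates. Then R(S31) = {(x,p,z,r) : ∃ (y,q) ∈ ℝ^{n₂} × ℝ^{n₂}, (x,p,y,q) ∈ R(S21) and (y,q,z,r) ∈ R(S32)}, i.e. the relation generated by the composed generating function S31 is the set-theoretic composition of the relations generated by S32 and S21. -/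
open Matrix

/-- The canonical relation generated by a generating function
`S : ℝⁿ × ℝᵐ → ℝ`: the set of `(x, p, y, q)` with `p = ∇_x S(x,q)` and
`y = ∇_q S(x,q)` (gradients expressed via `fderiv` and the dot product). -/
def genRel {n m : ℕ} (S : (Fin n → ℝ) → (Fin m → ℝ) → ℝ) :
    Set ((Fin n → ℝ) × (Fin n → ℝ) × (Fin m → ℝ) × (Fin m → ℝ)) :=
  {w | (∀ v, fderiv ℝ (fun x' => S x' w.2.2.2) w.1 v = w.2.1 ⬝ᵥ v)
    ∧ (∀ v, fderiv ℝ (fun q' => S w.1 q') w.2.2.2 v = w.2.2.1 ⬝ᵥ v)}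

/-- The quadratic generating function with constant term `s₀`, linear terms `s₁`, `s₂` and
quadratic blocks `A`, `B`, `C`. -/
noncomputable def quadraticGen {n m : ℕ} (s₀ : ℝ) (s₁ : Fin n → ℝ) (s₂ : Fin m → ℝ)
    (A : Matrix (Fin n) (Fin n) ℝ) (B : Matrix (Fin n) (Fin m) ℝ) (C : Matrix (Fin m) (Fin m) ℝ)
    (x : Fin n → ℝ) (q : Fin m → ℝ) : ℝ :=
  s₀ + s₁ ⬝ᵥ x + s₂ ⬝ᵥ q + (1/2) * (x ⬝ᵥ A.mulVec x) + x ⬝ᵥ B.mulVec q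
    + (1/2) * (q ⬝ᵥ C.mulVec q)

lemma Differentiable.dotProduct {E : Type*} [NormedAddCommGroup E] [NormedSpace ℝ E] {n : ℕ}
    {f g : E → Fin n → ℝ} (hf : Differentiable ℝ f) (hg : Differentiable ℝ g) :
    Differentiable ℝ fun e => f e ⬝ᵥ g e := by
  simp only [_root_.dotProduct]
  fun_prop

lemma Differentiable.matrix_mulVec {E : Type*} [NormedAddCommGroup E] [NormedSpace ℝ E] {n m : ℕ}
    (A : Matrix (Fin m) (Fin n) ℝ) {f : E → Fin n → ℝ} (hf : Differentiable ℝ f) :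
    Differentiable ℝ fun e => A *ᵥ f e :=
  differentiable_pi.2 fun i => (differentiable_const (A i)).dotProduct hf

lemma Differentiable.quadraticGen {E : Type*} [NormedAddCommGroup E] [NormedSpace ℝ E] {n m : ℕ}
    (s₀ : ℝ) (s₁ : Fin n → ℝ) (s₂ : Fin m → ℝ) (A : Matrix (Fin n) (Fin n) ℝ)
    (B : Matrix (Fin n) (Fin m) ℝ) (C : Matrix (Fin m) (Fin m) ℝ)
    {f : E → Fin n → ℝ} {g : E → Fin m → ℝ} (hf : Differentiable ℝ f) (hg : Differentiable ℝ g) :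
    Differentiable ℝ fun e => quadraticGen s₀ s₁ s₂ A B C (f e) (g e) :=
  ((((((differentiable_const s₀).add ((differentiable_const s₁).dotProduct hf)).add
    ((differentiable_const s₂).dotProduct hg)).add
    ((hf.dotProduct (hf.matrix_mulVec A)).const_mul _)).add
    (hf.dotProduct (hg.matrix_mulVec B))).add
    ((hg.dotProduct (hg.matrix_mulVec C)).const_mul _))

lemma Matrix.dotProduct_mulVec_eq_transpose {n m : ℕ} (A : Matrix (Fin n) (Fin m) ℝ)
    (v : Fin n → ℝ) (w : Fin m → ℝ) : v ⬝ᵥ A *ᵥ w = (Aᵀ *ᵥ v) ⬝ᵥ w := by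
  rw [dotProduct_mulVec, mulVec_transpose]

lemma quadraticGen_central_difference {n m : ℕ}
    (s₀ : ℝ) (s₁ : Fin n → ℝ) (s₂ : Fin m → ℝ) {A : Matrix (Fin n) (Fin n) ℝ}
    (B : Matrix (Fin n) (Fin m) ℝ) {C : Matrix (Fin m) (Fin m) ℝ} (hA : A.IsSymm) (hC : C.IsSymm)
    (x v : Fin n → ℝ) (q w : Fin m → ℝ) :
    quadraticGen s₀ s₁ s₂ A B C (x + v) (q + w) - quadraticGen s₀ s₁ s₂ A B C (x - v) (q - w)
      = 2 * ((s₁ + A *ᵥ x + B *ᵥ q) ⬝ᵥ v + (s₂ + Bᵀ *ᵥ x + C *ᵥ q) ⬝ᵥ w) := by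
  have hx : x ⬝ᵥ A *ᵥ v = (A *ᵥ x) ⬝ᵥ v := by rw [dotProduct_mulVec_eq_transpose, hA.eq]
  have hq : q ⬝ᵥ C *ᵥ w = (C *ᵥ q) ⬝ᵥ w := by rw [dotProduct_mulVec_eq_transpose, hC.eq]
  simp only [quadraticGen, mulVec_add, mulVec_sub, dotProduct_add, dotProduct_sub, add_dotProduct,
    sub_dotProduct, hx, hq, dotProduct_mulVec_eq_transpose B x w, dotProduct_comm v,
    dotProduct_comm w (C *ᵥ q)]
  ring

lemma fderiv_apply_of_central_difference {E : Type*} [NormedAddCommGroup E] [NormedSpace ℝ E]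
    {F : E → ℝ} {x : E} {L : E → ℝ} (hF : DifferentiableAt ℝ F x)
    (h : ∀ v, F (x + v) - F (x - v) = 2 * L v) (hL : ∀ (c : ℝ) v, L (c • v) = c * L v) (v : E) :
    fderiv ℝ F x v = L v := by
  have hp := hF.hasFDerivAt.hasLineDerivAt v
  have hm := hF.hasFDerivAt.hasLineDerivAt (-v)
  have hl : HasDerivAt (fun t : ℝ => F (x + t • v) - F (x + t • -v)) (2 * L v) 0 := by
    have : (fun t : ℝ => F (x + t • v) - F (x + t • -v)) = fun t => t * (2 * L v) := by
      funext t
      rw [smul_neg, ← sub_eq_add_neg, h, hL]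
      ring
    rw [this]
    exact hasDerivAt_mul_const _
  have := (HasDerivAt.sub hp hm).unique hl
  rw [map_neg] at this
  linarith

lemma mem_genRel_iff_of_central_difference {n m : ℕ} {S : (Fin n → ℝ) → (Fin m → ℝ) → ℝ}
    (hS : Differentiable ℝ fun e : (Fin n → ℝ) × (Fin m → ℝ) => S e.1 e.2)
    {x g : Fin n → ℝ} {q h : Fin m → ℝ}
    (hgh : ∀ v w, S (x + v) (q + w) - S (x - v) (q - w) = 2 * (g ⬝ᵥ v + h ⬝ᵥ w))
    (p : Fin n → ℝ) (y : Fin m → ℝ) :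
    (x, p, y, q) ∈ genRel S ↔ p = g ∧ y = h := by
  have hx : ∀ v, fderiv ℝ (fun x' => S x' q) x v = g ⬝ᵥ v :=
    fderiv_apply_of_central_difference
      (hS.comp (differentiable_id.prodMk (differentiable_const q)) x)
      (fun v => by simpa using hgh v 0) (fun c v => by simp)
  have hq : ∀ w, fderiv ℝ (fun q' => S x q') q w = h ⬝ᵥ w :=
    fderiv_apply_of_central_difference
      (hS.comp ((differentiable_const x).prodMk differentiable_id) q)
      (fun w => by simpa using hgh 0 w) (fun c w => by simp)
  simp only [genRel, Set.mem_ofPred_eq, hx, hq, dotProduct_eq_iff, eq_comm]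

lemma mem_genRel_quadraticGen_iff {n m : ℕ}
    (s₀ : ℝ) (s₁ : Fin n → ℝ) (s₂ : Fin m → ℝ) {A : Matrix (Fin n) (Fin n) ℝ}
    (B : Matrix (Fin n) (Fin m) ℝ) {C : Matrix (Fin m) (Fin m) ℝ} (hA : A.IsSymm) (hC : C.IsSymm)
    (x p : Fin n → ℝ) (y q : Fin m → ℝ) :
    (x, p, y, q) ∈ genRel (quadraticGen s₀ s₁ s₂ A B C)
      ↔ p = s₁ + A *ᵥ x + B *ᵥ q ∧ y = s₂ + Bᵀ *ᵥ x + C *ᵥ q :=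
  mem_genRel_iff_of_central_difference
    (differentiable_fst.quadraticGen s₀ s₁ s₂ A B C differentiable_snd)
    (fun v w => quadraticGen_central_difference s₀ s₁ s₂ B hA hC x v q w) p y

/-- The relation generated by the composed generating function
`S31(x,r) = S32(y₀,r) + S21(x,q₀) − y₀·q₀` is the set-theoretic composition of the
relations generated by `S32` and `S21` (purely even linear/quadratic case). -/
theorem composed_generating_function_composes_relations (n₁ n₂ n₃ : ℕ)
    (hn₁ : 1 ≤ n₁) (hn₂ : 1 ≤ n₂) (hn₃ : 1 ≤ n₃)
    (s₀ : ℝ) (s₁ : Fin n₁ → ℝ) (s₂ : Fin n₂ → ℝ)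
    (S₁₁ : Matrix (Fin n₁) (Fin n₁) ℝ) (S₁₂ : Matrix (Fin n₁) (Fin n₂) ℝ)
    (S₂₂ : Matrix (Fin n₂) (Fin n₂) ℝ) (hS₁₁ : S₁₁.IsSymm) (hS₂₂ : S₂₂.IsSymm)
    (t₀ : ℝ) (t₁ : Fin n₂ → ℝ) (t₂ : Fin n₃ → ℝ)
    (T₁₁ : Matrix (Fin n₂) (Fin n₂) ℝ) (T₁₂ : Matrix (Fin n₂) (Fin n₃) ℝ)
    (T₂₂ : Matrix (Fin n₃) (Fin n₃) ℝ) (hT₁₁ : T₁₁.IsSymm) (hT₂₂ : T₂₂.IsSymm)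
    -- invertibility of 1 − T₁₁S₂₂
    (hInv : IsUnit (1 - T₁₁ * S₂₂))
    (S21 : (Fin n₁ → ℝ) → (Fin n₂ → ℝ) → ℝ)
    (hS21 : ∀ x q, S21 x q = s₀ + s₁ ⬝ᵥ x + s₂ ⬝ᵥ q + (1/2) * (x ⬝ᵥ S₁₁.mulVec x)
      + x ⬝ᵥ S₁₂.mulVec q + (1/2) * (q ⬝ᵥ S₂₂.mulVec q))
    (S32 : (Fin n₂ → ℝ) → (Fin n₃ → ℝ) → ℝ)
    (hS32 : ∀ y r, S32 y r = t₀ + t₁ ⬝ᵥ y + t₂ ⬝ᵥ r + (1/2) * (y ⬝ᵥ T₁₁.mulVec y)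
      + y ⬝ᵥ T₁₂.mulVec r + (1/2) * (r ⬝ᵥ T₂₂.mulVec r))
    -- the unique stationary pair (y₀, q₀) for each (x, r)
    (y₀ q₀ : (Fin n₁ → ℝ) → (Fin n₃ → ℝ) → (Fin n₂ → ℝ))
    (hstat1 : ∀ x r, q₀ x r = t₁ + T₁₁.mulVec (y₀ x r) + T₁₂.mulVec r)
    (hstat2 : ∀ x r, y₀ x r = s₂ + S₁₂ᵀ.mulVec x + S₂₂.mulVec (q₀ x r))
    -- the composed generating function
    (S31 : (Fin n₁ → ℝ) → (Fin n₃ → ℝ) → ℝ)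
    (hS31 : ∀ x r, S31 x r = S32 (y₀ x r) r + S21 x (q₀ x r) - y₀ x r ⬝ᵥ q₀ x r) :
    genRel S31
      = {w | ∃ y q : Fin n₂ → ℝ,
          (w.1, w.2.1, y, q) ∈ genRel S21 ∧ (y, q, w.2.2.1, w.2.2.2) ∈ genRel S32} := by
  obtain rfl : S21 = quadraticGen s₀ s₁ s₂ S₁₁ S₁₂ S₂₂ := funext fun x => funext (hS21 x)
  obtain rfl : S32 = quadraticGen t₀ t₁ t₂ T₁₁ T₁₂ T₂₂ := funext fun y => funext (hS32 y)
  obtain ⟨U, hU⟩ : ∃ U, U * (1 - T₁₁ * S₂₂) = 1 := hInv.exists_left_inv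
  have solve {x r y q} (hq : q = t₁ + T₁₁ *ᵥ y + T₁₂ *ᵥ r) (hy : y = s₂ + S₁₂ᵀ *ᵥ x + S₂₂ *ᵥ q) :
      q = U *ᵥ (t₁ + T₁₁ *ᵥ (s₂ + S₁₂ᵀ *ᵥ x) + T₁₂ *ᵥ r) := by
    have : (1 - T₁₁ * S₂₂) *ᵥ q = t₁ + T₁₁ *ᵥ (s₂ + S₁₂ᵀ *ᵥ x) + T₁₂ *ᵥ r := by
      rw [sub_mulVec, one_mulVec, ← mulVec_mulVec, sub_eq_iff_eq_add]
      conv_lhs => rw [hq, hy]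
      rw [mulVec_add T₁₁ _ (S₂₂ *ᵥ q)]
      abel
    rw [← this, mulVec_mulVec, hU, one_mulVec]
  have hq₀ x r := solve (hstat1 x r) (hstat2 x r)
  have hq₀_diff : Differentiable ℝ fun e : (Fin n₁ → ℝ) × (Fin n₃ → ℝ) => q₀ e.1 e.2 := by
    simp only [hq₀]
    exact ((((((differentiable_fst.matrix_mulVec _).const_add _).matrix_mulVec _).const_add _).add
      (differentiable_snd.matrix_mulVec _)).matrix_mulVec _)
  have hy₀_diff : Differentiable ℝ fun e : (Fin n₁ → ℝ) × (Fin n₃ → ℝ) => y₀ e.1 e.2 := by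
    simp only [hstat2]
    exact ((differentiable_fst.matrix_mulVec _).const_add _).add (hq₀_diff.matrix_mulVec _)
  have hS31_diff : Differentiable ℝ fun e : (Fin n₁ → ℝ) × (Fin n₃ → ℝ) => S31 e.1 e.2 := by
    simp only [hS31]
    exact ((hy₀_diff.quadraticGen _ _ _ _ _ _ differentiable_snd).add
      (differentiable_fst.quadraticGen _ _ _ _ _ _ hq₀_diff)).sub (hy₀_diff.dotProduct hq₀_diff)
  have hS31_central x r v w : S31 (x + v) (r + w) - S31 (x - v) (r - w)
      = 2 * ((s₁ + S₁₁ *ᵥ x + S₁₂ *ᵥ q₀ x r) ⬝ᵥ v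
        + (t₂ + T₁₂ᵀ *ᵥ y₀ x r + T₂₂ *ᵥ r) ⬝ᵥ w) := by
    obtain ⟨dq, hqp, hqm⟩ : ∃ dq, q₀ (x + v) (r + w) = q₀ x r + dq ∧
        q₀ (x - v) (r - w) = q₀ x r - dq := by
      refine ⟨U *ᵥ (T₁₁ *ᵥ (S₁₂ᵀ *ᵥ v) + T₁₂ *ᵥ w), ?_, ?_⟩ <;>
      · simp only [hq₀, mulVec_add, mulVec_sub]
        abel
    obtain ⟨dy, hyp, hym⟩ : ∃ dy, y₀ (x + v) (r + w) = y₀ x r + dy ∧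
        y₀ (x - v) (r - w) = y₀ x r - dy := by
      refine ⟨S₁₂ᵀ *ᵥ v + S₂₂ *ᵥ dq, ?_, ?_⟩
      · rw [hstat2, hqp, hstat2 x r]
        simp only [mulVec_add]
        abel
      · rw [hstat2, hqm, hstat2 x r]
        simp only [mulVec_sub]
        abel
    have h32 := quadraticGen_central_difference t₀ t₁ t₂ T₁₂ hT₁₁ hT₂₂ (y₀ x r) dy r w
    have h21 := quadraticGen_central_difference s₀ s₁ s₂ S₁₂ hS₁₁ hS₂₂ x v (q₀ x r) dq
    rw [← hstat1] at h32
    rw [← hstat2] at h21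
    have hdot : (y₀ x r + dy) ⬝ᵥ (q₀ x r + dq) - (y₀ x r - dy) ⬝ᵥ (q₀ x r - dq)
        = 2 * (y₀ x r ⬝ᵥ dq + q₀ x r ⬝ᵥ dy) := by
      simp only [dotProduct_add, dotProduct_sub, add_dotProduct, sub_dotProduct,
        dotProduct_comm dy (q₀ x r)]
      ring
    rw [hS31, hS31, hqp, hqm, hyp, hym]
    linarith
  ext ⟨x, p, z, r⟩
  simp only [mem_genRel_iff_of_central_difference hS31_diff (hS31_central x r), Set.mem_ofPred_eq,
    mem_genRel_quadraticGen_iff _ _ _ _ hS₁₁ hS₂₂, mem_genRel_quadraticGen_iff _ _ _ _ hT₁₁ hT₂₂]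
  constructor
  · rintro ⟨hp, hz⟩
    exact ⟨y₀ x r, q₀ x r, ⟨hp, hstat2 x r⟩, hstat1 x r, hz⟩
  · rintro ⟨y, q, ⟨hp, hy⟩, hq, hz⟩
    have hqq : q = q₀ x r := (solve hq hy).trans (hq₀ x r).symm
    have hyy : y = y₀ x r := by rw [hy, hqq, ← hstat2]
    exact ⟨hqq ▸ hp, hyy ▸ hz⟩
end
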